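/- Fix ε > 0 and ε' > 0. Then there is a constant c₄ > 0, depending only on ε, ε' and b, such that for every Δ ∈ [0,1) and every real y with ε' ≤ Δ − x₀ − ε ≤ y ≤ 1, one has (1−y) log_b(1−y) + (Δ/2)(1−y) − (x₀+ε)/2 ≤ −c₄. -/

import Mathlib

/-- `φ(x) = (1−Δ+x) log_b(1−Δ+x) + (1−Δ)(Δ−x)/2`, where `log_b y = log y / log b`
(`Real.logb`), and `0 · log_b 0` is interpreted as `0` (automatic, since `Real.log 0 = 0`). -/
noncomputable def phiFun (b Δ x : ℝ) : ℝ :=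
  (1 - Δ + x) * Real.logb b (1 - Δ + x) + (1 - Δ) * (Δ - x) / 2

/-- `x₀`: the smallest nonnegative solution `x` of `φ(x) ≤ 0`. -/
noncomputable def xZero (b Δ : ℝ) : ℝ := sInf {x : ℝ | 0 ≤ x ∧ phiFun b Δ x ≤ 0}

theorem continuous_phiFun (b Δ : ℝ) : Continuous (phiFun b Δ) := by
  have h : Continuous fun x : ℝ => (1 - Δ + x) * Real.log (1 - Δ + x) :=
    Real.continuous_mul_log.comp (continuous_const.add continuous_id)
  have h' : phiFun b Δ = fun x =>
      (1 - Δ + x) * Real.log (1 - Δ + x) / Real.log b + (1 - Δ) * (Δ - x) / 2 := by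
    funext x
    simp only [phiFun, Real.logb, mul_div_assoc]
  rw [h']
  fun_prop

theorem xZero_mem {Δ : ℝ} (b : ℝ) (hΔ : 0 ≤ Δ) :
    0 ≤ xZero b Δ ∧ phiFun b Δ (xZero b Δ) ≤ 0 := by
  have hclosed : IsClosed {x : ℝ | 0 ≤ x ∧ phiFun b Δ x ≤ 0} :=
    isClosed_Ici.inter (isClosed_le (continuous_phiFun b Δ) continuous_const)
  exact hclosed.csInf_mem ⟨Δ, hΔ, by simp [phiFun]⟩ ⟨0, fun x hx => hx.1⟩

theorem convexOn_mul_log_sub_sq_div_two :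
    ConvexOn ℝ (Set.Icc 0 1) fun x : ℝ => x * Real.log x - x ^ 2 / 2 := by
  have hderiv : ∀ x : ℝ, x ≠ 0 →
      HasDerivAt (fun x : ℝ => x * Real.log x - x ^ 2 / 2) (Real.log x + 1 - x) x := by
    intro x hx
    refine ((Real.hasDerivAt_mul_log hx).sub ((hasDerivAt_pow 2 x).div_const 2)).congr_deriv ?_
    norm_num
  refine MonotoneOn.convexOn_of_deriv (convex_Icc 0 1) ?_ ?_ ?_
  · exact (Real.continuous_mul_log.sub ((continuous_pow 2).div_const 2)).continuousOn
  · rw [interior_Icc]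
    exact fun x hx => (hderiv x hx.1.ne').differentiableAt.differentiableWithinAt
  · rw [interior_Icc]
    intro x hx y hy hxy
    rw [(hderiv x hx.1.ne').deriv, (hderiv y hy.1.ne').deriv]
    have h := Real.log_le_sub_one_of_pos (div_pos hx.1 hy.1)
    rw [Real.log_div hx.1.ne' hy.1.ne'] at h
    have h' : x / y - 1 ≤ x - y := by
      rw [div_sub_one hy.1.ne', div_le_iff₀ hy.1]
      nlinarith [hy.2]
    linarith

/-- The chord bound for `x log x` on `[u, 1]` with the gain due to its strong convexity. -/
theorem mul_log_le_chord_sub {u w : ℝ} (hu : 0 ≤ u) (huw : u ≤ w) (hw : w < 1) :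
    (1 - u) * (w * Real.log w) ≤
      (1 - w) * (u * Real.log u) - (w - u) * (1 - w) * (1 - u) / 2 := by
  have hu1 : 0 < 1 - u := by linarith
  have hu_mem : u ∈ Set.Icc (0 : ℝ) 1 := ⟨hu, by linarith⟩
  have hone_mem : (1 : ℝ) ∈ Set.Icc (0 : ℝ) 1 := ⟨zero_le_one, le_rfl⟩
  have ha : 0 ≤ (1 - w) / (1 - u) := div_nonneg (by linarith) hu1.le
  have hb : 0 ≤ (w - u) / (1 - u) := div_nonneg (by linarith) hu1.le
  have hab : (1 - w) / (1 - u) + (w - u) / (1 - u) = 1 := by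
    field_simp
    ring
  have h := convexOn_mul_log_sub_sq_div_two.2 hu_mem hone_mem ha hb hab
  have hcomb : (1 - w) / (1 - u) * u + (w - u) / (1 - u) * 1 = w := by
    field_simp
    ring
  simp only [smul_eq_mul, hcomb, Real.log_one] at h
  have h' := mul_le_mul_of_nonneg_left h hu1.le
  have hrhs : (1 - u) * ((1 - w) / (1 - u) * (u * Real.log u - u ^ 2 / 2) +
      (w - u) / (1 - u) * (1 * 0 - 1 ^ 2 / 2)) =
      (1 - w) * (u * Real.log u - u ^ 2 / 2) - (w - u) / 2 := by
    field_simp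
    ring
  rw [hrhs] at h'
  linarith

theorem phiFun_add_le {b Δ x ε : ℝ} (hb : 1 < b) (hΔ : Δ < 1) (hx : 0 ≤ x)
    (hφ : phiFun b Δ x ≤ 0) (hε : 0 ≤ ε) (hxΔ : x + ε < Δ) :
    phiFun b Δ (x + ε) ≤ -(ε * (Δ - x - ε) / (2 * Real.log b)) := by
  have hL : 0 < Real.log b := Real.log_pos hb
  have hchord := mul_log_le_chord_sub (u := 1 - Δ + x) (w := 1 - Δ + (x + ε))
    (by linarith) (by linarith) (by linarith)
  have hclear : ∀ z, Real.log b * phiFun b Δ z =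
      (1 - Δ + z) * Real.log (1 - Δ + z) + Real.log b * ((1 - Δ) * (Δ - z) / 2) := by
    intro z
    simp only [phiFun, Real.logb]
    field_simp
  have hφ' := mul_nonpos_of_nonneg_of_nonpos (by linarith : 0 ≤ Δ - (x + ε))
    (mul_nonpos_of_nonneg_of_nonpos hL.le hφ)
  rw [hclear] at hφ'
  have hkey : Real.log b * phiFun b Δ (x + ε) ≤ -(ε * (Δ - x - ε) / 2) := by
    rw [hclear]
    refine le_of_mul_le_mul_left ?_ (by linarith : 0 < Δ - x)
    linarith
  rw [← neg_div, le_div_iff₀ (by positivity)]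
  linarith

/-- **(12) Lemma 3.6.** Fix `ε > 0` and `ε' > 0`.  Then there is a constant `c₄ > 0`,
depending only on `ε`, `ε'` and `b`, such that for every `Δ ∈ [0,1)` and every real `y`
with `ε' ≤ Δ − x₀ − ε ≤ y ≤ 1`, one has
`(1−y) log_b(1−y) + (Δ/2)(1−y) − (x₀+ε)/2 ≤ −c₄`. -/
theorem psi_upper_bound_high
    (b : ℝ) (hb : 1 < b) (ε ε' : ℝ) (hε : 0 < ε) (hε' : 0 < ε') :
    ∃ c₄ > (0 : ℝ), ∀ Δ ∈ Set.Ico (0 : ℝ) 1, ∀ y : ℝ,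
      ε' ≤ Δ - xZero b Δ - ε → Δ - xZero b Δ - ε ≤ y → y ≤ 1 →
        (1 - y) * Real.logb b (1 - y) + (Δ / 2) * (1 - y) - (xZero b Δ + ε) / 2 ≤ -c₄ := by
  have hL : 0 < Real.log b := Real.log_pos hb
  refine ⟨min (ε / 2) (ε * ε' / (2 * Real.log b)), lt_min (by positivity) (by positivity), ?_⟩
  intro Δ hΔ y hy₁ hy₂ hy₃
  obtain ⟨hx, hφ⟩ := xZero_mem b hΔ.1
  set x := xZero b Δ
  set c := min (ε / 2) (ε * ε' / (2 * Real.log b))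
  have hw : 0 < 1 - Δ + (x + ε) := by linarith [hΔ.2]
  have hφw : phiFun b Δ (x + ε) ≤ -c := by
    refine (phiFun_add_le hb hΔ.2 hx hφ hε.le (by linarith)).trans (neg_le_neg ?_)
    refine (min_le_right _ _).trans ?_
    gcongr
  have hc : c ≤ (x + ε) / 2 := (min_le_left _ _).trans (by linarith)
  have hlog : (1 - y) * Real.logb b (1 - y) ≤ (1 - y) * Real.logb b (1 - Δ + (x + ε)) := by
    rcases hy₃.eq_or_lt with rfl | hy
    · simp
    · exact mul_le_mul_of_nonneg_left
        (Real.logb_le_logb_of_le hb (by linarith) (by linarith)) (by linarith)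
  unfold phiFun at hφw
  generalize Real.logb b (1 - Δ + (x + ε)) = l at *
  have h₁ := mul_le_mul_of_nonneg_left hφw (by linarith : 0 ≤ 1 - y)
  have h₂ := mul_le_mul_of_nonneg_left hc (by linarith : 0 ≤ 1 - Δ + (x + ε) - (1 - y))
  have h₃ := mul_le_mul_of_nonneg_left hlog hw.le
  refine le_of_mul_le_mul_left ?_ hw
  linarith
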